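/- (New phase transition.) Fix η ∈ (0,1), a constant c̄ > 0, and a constant α > 0. There exist sufficiently small constants c₁, c₂ > 0 and constants c, C > 0 such that for all positive integers d₁, d₂ and integers 1 ≤ s₁ ≤ d₁, 1 ≤ s₂ ≤ d₂ satisfying s₁² ≥ c̄·d₁·s₂, s₁ ≤ c₁·d₁, s₂ ≤ c₂·d₂, d₁/s₁ ≥ e·log(d₂/s₂), and d₂ ≥ s₂^{2+α}, the minimax separation rate satisfies c·T ≤ (μ*)² ≤ C·T, where T = (1/s₂)·log(1 + (d₁·s₂/s₁²)·log(d₂)). -/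

import Mathlib

open MeasureTheory ProbabilityTheory

noncomputable def Pmeas (d₁ d₂ : ℕ) (X : Fin d₁ → Fin d₂ → ℝ) :
    Measure (Fin d₁ → Fin d₂ → ℝ) :=
  Measure.pi fun i => Measure.pi fun j => gaussianReal (X i j) 1

def Theta (d₁ d₂ s₁ s₂ : ℕ) (μ : ℝ) : Set (Fin d₁ → Fin d₂ → ℝ) :=
  {X | ∃ (S₁ : Finset (Fin d₁)) (S₂ : Finset (Fin d₂)),
    S₁.card = s₁ ∧ S₂.card = s₂ ∧
    (∀ i j, i ∈ S₁ → j ∈ S₂ → μ ≤ X i j) ∧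
    (∀ i j, ¬(i ∈ S₁ ∧ j ∈ S₂) → X i j = 0)}

noncomputable def risk (d₁ d₂ s₁ s₂ : ℕ) (μ : ℝ)
    (Δ : (Fin d₁ → Fin d₂ → ℝ) → Bool) : ℝ :=
  (Pmeas d₁ d₂ 0 {y | Δ y = true}).toReal +
    ⨆ X ∈ Theta d₁ d₂ s₁ s₂ μ, (Pmeas d₁ d₂ X {y | Δ y = false}).toReal

noncomputable def muStar (η : ℝ) (d₁ d₂ s₁ s₂ : ℕ) : ℝ :=
  sInf {μ : ℝ | 0 < μ ∧ ∃ Δ : (Fin d₁ → Fin d₂ → ℝ) → Bool,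
    Measurable Δ ∧ risk d₁ d₂ s₁ s₂ μ Δ < η}



theorem lintegral_pi_prod {ι : Type*} [Fintype ι] {Ω : ι → Type*} [∀ i, MeasurableSpace (Ω i)]
    (μ : ∀ i, Measure (Ω i)) [∀ i, IsProbabilityMeasure (μ i)]
    (f : ∀ i, Ω i → ENNReal) (hf : ∀ i, Measurable (f i)) :
    ∫⁻ x, ∏ i, f i (x i) ∂(Measure.pi μ) = ∏ i, ∫⁻ x, f i x ∂(μ i) := by
  have h := iIndepFun_pi (μ := μ) (X := f) (fun i => (hf i).aemeasurable)
  have h2 := lintegral_prod_eq_prod_lintegral_of_indepFun Finset.univ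
    (fun i (x : ∀ i, Ω i) => f i (x i)) h (fun i => (hf i).comp (measurable_pi_apply i))
  rw [h2]
  refine Finset.prod_congr rfl fun i _ => ?_
  exact (measurePreserving_eval μ i).lintegral_comp (hf i)

theorem pi_withDensity_prod {ι : Type*} [Fintype ι] {Ω : ι → Type*} [∀ i, MeasurableSpace (Ω i)]
    (μ : ∀ i, Measure (Ω i)) [∀ i, IsProbabilityMeasure (μ i)]
    (f : ∀ i, Ω i → ENNReal) (hf : ∀ i, Measurable (f i))
    [∀ i, SigmaFinite ((μ i).withDensity (f i))] :
    Measure.pi (fun i => (μ i).withDensity (f i)) =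
      (Measure.pi μ).withDensity (fun x => ∏ i, f i (x i)) := by
  refine Measure.pi_eq fun s hs => ?_
  rw [withDensity_apply _ (MeasurableSet.univ_pi hs), ← lintegral_indicator (MeasurableSet.univ_pi hs)]
  have : ∀ x : ∀ i, Ω i, (Set.univ.pi s).indicator (fun x => ∏ i, f i (x i)) x =
      ∏ i, (s i).indicator (f i) (x i) := by
    intro x
    by_cases hx : x ∈ Set.univ.pi s
    · rw [Set.indicator_of_mem hx]
      exact Finset.prod_congr rfl fun i _ => (Set.indicator_of_mem (hx i trivial) _).symm
    · rw [Set.indicator_of_notMem hx]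
      simp only [Set.mem_pi, not_forall] at hx
      obtain ⟨i, _, hi⟩ := hx
      exact (Finset.prod_eq_zero (Finset.mem_univ i) (Set.indicator_of_notMem hi _)).symm
  simp_rw [this]
  rw [lintegral_pi_prod μ _ (fun i => (hf i).indicator (hs i))]
  exact Finset.prod_congr rfl fun i _ => by
    rw [lintegral_indicator (hs i), withDensity_apply _ (hs i)]

theorem lintegral_exp_mul_gaussianReal (v a b : ℝ) :
    ∫⁻ y, ENNReal.ofReal (Real.exp (a * y + b)) ∂(gaussianReal v 1) =
      ENNReal.ofReal (Real.exp (a * v + a ^ 2 / 2 + b)) := by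
  have h := congrFun (mgf_id_gaussianReal (μ := v) (v := 1)) a
  have hi : Integrable (fun y : ℝ => Real.exp (a * y)) (gaussianReal v 1) :=
    integrable_exp_mul_gaussianReal a
  rw [← ofReal_integral_eq_lintegral_ofReal (by simpa [Real.exp_add] using hi.mul_const _)
    (Filter.Eventually.of_forall fun _ => (Real.exp_pos _).le)]
  simp only [mgf, id] at h
  simp only [Real.exp_add, integral_mul_const, h]
  congr 1
  simp [mul_comm]

theorem withDensity_exp_gaussianReal (v : ℝ) :
    (gaussianReal 0 1).withDensity
      (fun y => ENNReal.ofReal (Real.exp (v * y + -(v ^ 2 / 2)))) = gaussianReal v 1 := by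
  rw [gaussianReal_of_var_ne_zero _ one_ne_zero, gaussianReal_of_var_ne_zero _ one_ne_zero,
    ← withDensity_mul _ (measurable_gaussianPDF _ _) (by fun_prop)]
  congr 1
  ext y
  simp only [Pi.mul_apply, gaussianPDF, gaussianPDFReal]
  rw [← ENNReal.ofReal_mul (by positivity), mul_assoc, ← Real.exp_add]
  congr 3
  simp; ring

theorem lintegral_exp_sum_pi_gaussianReal {n : ℕ} (v a b : Fin n → ℝ) :
    ∫⁻ y, ENNReal.ofReal (Real.exp (∑ j, (a j * y j + b j)))
        ∂(Measure.pi fun j => gaussianReal (v j) 1) =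
      ENNReal.ofReal (Real.exp (∑ j, (a j * v j + a j ^ 2 / 2 + b j))) := by
  simp_rw [Real.exp_sum, ENNReal.ofReal_prod_of_nonneg (fun _ _ => (Real.exp_pos _).le)]
  rw [lintegral_pi_prod (fun j => gaussianReal (v j) 1)
    (fun j y => ENNReal.ofReal (Real.exp (a j * y + b j))) (fun j => by fun_prop)]
  simp_rw [lintegral_exp_mul_gaussianReal]


instance isProbabilityMeasure_Pmeas (d₁ d₂ : ℕ) (X : Fin d₁ → Fin d₂ → ℝ) :
    IsProbabilityMeasure (Pmeas d₁ d₂ X) := by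
  unfold Pmeas; infer_instance

theorem lintegral_exp_Pmeas {d₁ d₂ : ℕ} (X A B : Fin d₁ → Fin d₂ → ℝ) :
    ∫⁻ y, ENNReal.ofReal (Real.exp (∑ i, ∑ j, (A i j * y i j + B i j))) ∂(Pmeas d₁ d₂ X) =
      ENNReal.ofReal (Real.exp (∑ i, ∑ j, (A i j * X i j + A i j ^ 2 / 2 + B i j))) := by
  simp_rw [Real.exp_sum (Finset.univ : Finset (Fin d₁)),
    ENNReal.ofReal_prod_of_nonneg (fun _ _ => (Real.exp_pos _).le)]
  rw [Pmeas, lintegral_pi_prod (fun i => Measure.pi fun j => gaussianReal (X i j) 1)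
    (fun i y => ENNReal.ofReal (Real.exp (∑ j, (A i j * y j + B i j)))) (fun j => by fun_prop)]
  simp_rw [lintegral_exp_sum_pi_gaussianReal]

theorem Pmeas_eq_withDensity {d₁ d₂ : ℕ} (X : Fin d₁ → Fin d₂ → ℝ) :
    Pmeas d₁ d₂ X = (Pmeas d₁ d₂ 0).withDensity fun y =>
      ENNReal.ofReal (Real.exp (∑ i, ∑ j, (X i j * y i j + -(X i j ^ 2 / 2)))) := by
  have hrow : ∀ i, (Measure.pi fun j => gaussianReal (X i j) 1) =
      (Measure.pi fun _ : Fin d₂ => gaussianReal 0 1).withDensity fun y =>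
        ENNReal.ofReal (Real.exp (∑ j, (X i j * y j + -(X i j ^ 2 / 2)))) := by
    intro i
    have : ∀ j, IsProbabilityMeasure ((gaussianReal 0 1).withDensity
        (fun y => ENNReal.ofReal (Real.exp (X i j * y + -(X i j ^ 2 / 2))))) := fun j => by
      rw [withDensity_exp_gaussianReal]; infer_instance
    have h := pi_withDensity_prod (fun _ : Fin d₂ => gaussianReal 0 1)
      (fun j y => ENNReal.ofReal (Real.exp (X i j * y + -(X i j ^ 2 / 2)))) (fun j => by fun_prop)
    simp_rw [withDensity_exp_gaussianReal] at h
    rw [h]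
    simp_rw [Real.exp_sum, ENNReal.ofReal_prod_of_nonneg (fun _ _ => (Real.exp_pos _).le)]
  have : ∀ i, IsProbabilityMeasure ((Measure.pi fun _ : Fin d₂ => gaussianReal 0 1).withDensity
      fun y => ENNReal.ofReal (Real.exp (∑ j, (X i j * y j + -(X i j ^ 2 / 2))))) := fun i => by
    rw [← hrow]; infer_instance
  have h := pi_withDensity_prod (fun _ : Fin d₁ => Measure.pi fun _ : Fin d₂ => gaussianReal 0 1)
      (fun i y => ENNReal.ofReal (Real.exp (∑ j, (X i j * y j + -(X i j ^ 2 / 2)))))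
      (fun j => by fun_prop)
  simp_rw [← hrow] at h
  simp_rw [Real.exp_sum (Finset.univ : Finset (Fin d₁)),
    ENNReal.ofReal_prod_of_nonneg (fun _ _ => (Real.exp_pos _).le)]
  exact h

/-- The second moment method: a mixture whose likelihood ratio has second moment at most `1 + δ²`
cannot be distinguished from the null with total error smaller than `1 - δ`. -/
theorem one_sub_le_of_second_moment {Ω ι : Type*} [MeasurableSpace Ω] [Fintype ι] [Nonempty ι]
    (P : Measure Ω) [IsProbabilityMeasure P] (L : ι → Ω → ℝ) (hL : ∀ i, Measurable (L i))
    (hL0 : ∀ i ω, 0 ≤ L i ω) (hL1 : ∀ i, ∫⁻ ω, ENNReal.ofReal (L i ω) ∂P = 1)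
    (G : ι → ι → ℝ) (hG0 : ∀ i j, 0 ≤ G i j)
    (hG : ∀ i j, ∫⁻ ω, ENNReal.ofReal (L i ω * L j ω) ∂P = ENNReal.ofReal (G i j))
    {δ : ℝ} (hδ : 0 < δ)
    (hsum : ∑ i, ∑ j, G i j ≤ (Fintype.card ι : ℝ) ^ 2 * (1 + δ ^ 2))
    {A : Set Ω} (hA : MeasurableSet A) {r : ℝ}
    (hr : ∀ i, (P.withDensity (fun ω => ENNReal.ofReal (L i ω)) Aᶜ).toReal ≤ r) :
    1 - δ ≤ (P A).toReal + r := by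
  have hN : (0 : ℝ) < Fintype.card ι := by exact_mod_cast Fintype.card_pos
  set N : ℝ := (Fintype.card ι : ℝ) with hNdef
  have hint : ∀ i, Integrable (L i) P := fun i =>
    (lintegral_ofReal_ne_top_iff_integrable (hL i).aestronglyMeasurable
      (Filter.Eventually.of_forall (hL0 i))).1 (by rw [hL1]; simp)
  have hint1 : ∀ i, ∫ ω, L i ω ∂P = 1 := fun i => by
    rw [integral_eq_lintegral_of_nonneg_ae (Filter.Eventually.of_forall (hL0 i))
      (hL i).aestronglyMeasurable, hL1]; simp
  have hint2 : ∀ i j, Integrable (fun ω => L i ω * L j ω) P := fun i j =>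
    (lintegral_ofReal_ne_top_iff_integrable (f := fun ω => L i ω * L j ω)
      ((hL i).mul (hL j)).aestronglyMeasurable
      (Filter.Eventually.of_forall fun ω => mul_nonneg (hL0 i ω) (hL0 j ω))).1 (by rw [hG]; simp)
  have hintG : ∀ i j, ∫ ω, L i ω * L j ω ∂P = G i j := fun i j => by
    rw [integral_eq_lintegral_of_nonneg_ae
      (Filter.Eventually.of_forall fun ω => mul_nonneg (hL0 i ω) (hL0 j ω))
      ((hL i).mul (hL j)).aestronglyMeasurable, hG, ENNReal.toReal_ofReal (hG0 i j)]
  have hPi : ∀ i, 1 - r ≤ ∫ ω in A, L i ω ∂P := by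
    intro i
    have h1 : (P.withDensity (fun ω => ENNReal.ofReal (L i ω)) Aᶜ).toReal = ∫ ω in Aᶜ, L i ω ∂P := by
      rw [withDensity_apply _ hA.compl, integral_eq_lintegral_of_nonneg_ae
        (Filter.Eventually.of_forall (hL0 i)) (hL i).aestronglyMeasurable]
    have h2 := integral_add_compl hA (hint i)
    have h3 := hr i
    rw [hint1] at h2
    linarith
  set M : Ω → ℝ := fun ω => (∑ i, L i ω) / N with hM
  have hMint : Integrable M P := (integrable_finsetSum _ fun i _ => hint i).div_const _
  have hMsq : ∀ ω, M ω ^ 2 = (∑ i, ∑ j, L i ω * L j ω) / N ^ 2 := fun ω => by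
    simp only [hM, div_pow, sq (∑ i, L i ω), Finset.sum_mul_sum]
  have hM2int : Integrable (fun ω => M ω ^ 2) P := by
    simp_rw [hMsq]
    exact (integrable_finsetSum _ fun i _ => integrable_finsetSum _ fun j _ => hint2 i j).div_const _
  have hMi : ∫ ω, M ω ∂P = 1 := by
    simp only [hM]
    rw [integral_div, integral_finsetSum _ fun i _ => hint i]
    simp only [hint1, Finset.sum_const, Finset.card_univ, nsmul_eq_mul, mul_one]
    exact div_self hN.ne'
  have hM2i : ∫ ω, M ω ^ 2 ∂P ≤ 1 + δ ^ 2 := by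
    simp_rw [hMsq]
    rw [integral_div, integral_finsetSum _ fun i _ => integrable_finsetSum _ fun j _ => hint2 i j]
    simp_rw [integral_finsetSum _ fun j _ => hint2 _ j, hintG]
    rw [div_le_iff₀ (by positivity)]
    linarith
  have hMA : 1 - r ≤ ∫ ω in A, M ω ∂P := by
    simp only [hM]
    rw [integral_div, integral_finsetSum _ fun i _ => (hint i).integrableOn, le_div_iff₀ hN]
    calc (1 - r) * N = ∑ _i : ι, (1 - r) := by simp [hNdef]; ring
      _ ≤ _ := Finset.sum_le_sum fun i _ => hPi i
  have hquad : Integrable (fun ω => (M ω ^ 2 - 2 * M ω + 1 + δ ^ 2) / (2 * δ)) P :=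
    (((hM2int.sub (hMint.const_mul 2)).add (integrable_const _)).add (integrable_const _)).div_const _
  have hpos : ∀ ω, 0 ≤ (M ω ^ 2 - 2 * M ω + 1 + δ ^ 2) / (2 * δ) := fun ω => by
    apply div_nonneg _ (by positivity); nlinarith [sq_nonneg (M ω - 1), sq_nonneg δ]
  have h1 : ∫ ω in A, (M ω - 1) ∂P ≤ ∫ ω in A, (M ω ^ 2 - 2 * M ω + 1 + δ ^ 2) / (2 * δ) ∂P := by
    refine integral_mono (hMint.sub (integrable_const _)).integrableOn hquad.integrableOn fun ω => ?_
    rw [le_div_iff₀ (by positivity)]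
    nlinarith [sq_nonneg (M ω - 1 - δ)]
  have h2 := setIntegral_le_integral (s := A) hquad (Filter.Eventually.of_forall hpos)
  have h3 : ∫ ω, (M ω ^ 2 - 2 * M ω + 1 + δ ^ 2) / (2 * δ) ∂P ≤ δ := by
    have e1 : Integrable (fun ω => M ω ^ 2 - 2 * M ω) P := hM2int.sub (hMint.const_mul 2)
    have e2 : Integrable (fun ω => M ω ^ 2 - 2 * M ω + 1) P := e1.add (integrable_const 1)
    rw [integral_div, integral_add e2 (integrable_const _), integral_add e1 (integrable_const _),
      integral_sub hM2int (hMint.const_mul 2), integral_const_mul, hMi, div_le_iff₀ (by positivity)]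
    simp
    nlinarith
  rw [integral_sub hMint.integrableOn (integrable_const _)] at h1
  simp [measureReal_def] at h1
  linarith


theorem bddAbove_range_Pmeas_iSup_mem {d₁ d₂ : ℕ} (T : Set (Fin d₁ → Fin d₂ → ℝ))
    (A : Set (Fin d₁ → Fin d₂ → ℝ)) :
    BddAbove (Set.range fun X => ⨆ _ : X ∈ T, (Pmeas d₁ d₂ X A).toReal) := by
  refine ⟨1, ?_⟩
  rintro _ ⟨X, rfl⟩
  exact Real.iSup_le (fun _ => ENNReal.toReal_le_of_le_ofReal zero_le_one (by simpa using prob_le_one))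
    zero_le_one

theorem Pmeas_add_le_risk {d₁ d₂ s₁ s₂ : ℕ} {μ : ℝ} {Δ : (Fin d₁ → Fin d₂ → ℝ) → Bool}
    {r : ℝ} (hr : ∀ u, (∀ X ∈ Theta d₁ d₂ s₁ s₂ μ, (Pmeas d₁ d₂ X {y | Δ y = false}).toReal ≤ u) →
      r ≤ (Pmeas d₁ d₂ 0 {y | Δ y = true}).toReal + u) :
    r ≤ risk d₁ d₂ s₁ s₂ μ Δ := by
  refine hr _ fun X hX => ?_
  have h := le_ciSup (bddAbove_range_Pmeas_iSup_mem (Theta d₁ d₂ s₁ s₂ μ) {y | Δ y = false}) X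
  rwa [ciSup_pos hX] at h

/-- The transversal `{(i, f i)}` of the first `s` consecutive blocks of length `b` in `Fin d`. -/
def blockTransversal {s b d : ℕ} (h : s * b ≤ d) (f : Fin s → Fin b) : Finset (Fin d) :=
  Finset.univ.image fun i => Fin.castLE h (finProdFinEquiv (i, f i))

theorem injective_castLE_finProdFinEquiv {s b d : ℕ} (h : s * b ≤ d) :
    Function.Injective fun p : Fin s × Fin b => Fin.castLE h (finProdFinEquiv p) :=
  (Fin.castLE_injective h).comp finProdFinEquiv.injective

theorem card_blockTransversal {s b d : ℕ} (h : s * b ≤ d) (f : Fin s → Fin b) :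
    (blockTransversal h f).card = s := by
  rw [blockTransversal, Finset.card_image_of_injective, Finset.card_univ, Fintype.card_fin]
  intro i j hij
  exact (Prod.ext_iff.1 (injective_castLE_finProdFinEquiv h hij)).1

theorem card_blockTransversal_inter {s b d : ℕ} (h : s * b ≤ d) (f g : Fin s → Fin b) :
    (blockTransversal h f ∩ blockTransversal h g).card =
      (Finset.univ.filter fun i => f i = g i).card := by
  have : blockTransversal h f ∩ blockTransversal h g =
      (Finset.univ.filter fun i => f i = g i).image
        fun i => Fin.castLE h (finProdFinEquiv (i, f i)) := by
    ext x
    simp only [blockTransversal, Finset.mem_inter, Finset.mem_image, Finset.mem_univ, true_and,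
      Finset.mem_filter]
    constructor
    · rintro ⟨⟨i, rfl⟩, j, hj⟩
      have := injective_castLE_finProdFinEquiv h hj
      simp only [Prod.mk.injEq] at this
      obtain ⟨rfl, h2⟩ := this
      exact ⟨j, h2.symm, rfl⟩
    · rintro ⟨i, hi, rfl⟩
      exact ⟨⟨i, rfl⟩, i, by rw [hi]⟩
  rw [this, Finset.card_image_of_injective]
  intro i j hij
  exact (Prod.ext_iff.1 (injective_castLE_finProdFinEquiv h hij)).1

theorem sum_exp_card_agree_le {s b : ℕ} (hb : 0 < b) (l : ℝ) (g : Fin s → Fin b) :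
    ∑ f : Fin s → Fin b, Real.exp (l * (Finset.univ.filter fun i => f i = g i).card) ≤
      (b : ℝ) ^ s * Real.exp (s * (Real.exp l - 1) / b) := by
  have hb' : (0 : ℝ) < b := by exact_mod_cast hb
  have h1 : ∀ f : Fin s → Fin b,
      Real.exp (l * (Finset.univ.filter fun i => f i = g i).card) =
        ∏ i, (if f i = g i then Real.exp l else 1) := fun f => by
    rw [Finset.prod_ite]
    simp [← Real.exp_nat_mul, mul_comm]
  simp_rw [h1]
  have h2 := Finset.prod_univ_sum (fun _ : Fin s => (Finset.univ : Finset (Fin b)))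
    (fun i a => if a = g i then Real.exp l else (1 : ℝ))
  rw [Fintype.piFinset_univ] at h2
  rw [← h2]
  have h3 : ∀ i, ∑ a : Fin b, (if a = g i then Real.exp l else (1 : ℝ)) =
      b * (1 + (Real.exp l - 1) / b) := fun i => by
    have : ∀ a : Fin b, (if a = g i then Real.exp l else (1 : ℝ)) =
        1 + if a = g i then Real.exp l - 1 else 0 := fun a => by split_ifs <;> ring
    simp_rw [this, Finset.sum_add_distrib]
    simp
    field_simp
  simp_rw [h3]
  rw [Finset.prod_const, Finset.card_univ, Fintype.card_fin, mul_pow]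
  refine mul_le_mul_of_nonneg_left ?_ (by positivity)
  have h4 : 1 + (Real.exp l - 1) / b ≤ Real.exp ((Real.exp l - 1) / b) := by
    linarith [Real.add_one_le_exp ((Real.exp l - 1) / (b : ℝ))]
  have h5 : 0 ≤ 1 + (Real.exp l - 1) / (b : ℝ) := by
    have hb1 : (1 : ℝ) ≤ b := by exact_mod_cast hb
    have : -1 ≤ (Real.exp l - 1) / (b : ℝ) := by
      rw [le_div_iff₀ hb']; nlinarith [Real.exp_pos l]
    linarith
  calc _ ≤ Real.exp ((Real.exp l - 1) / b) ^ s := pow_le_pow_left₀ h5 h4 _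
    _ = _ := by rw [← Real.exp_nat_mul, mul_div_assoc]

theorem sum_exp_card_agree_mul_le {s₁ b₁ s₂ b₂ : ℕ} (hb₁ : 0 < b₁) (hb₂ : 0 < b₂) {l κ : ℝ}
    (hκ : ∀ k : ℕ, k ≤ s₂ → s₁ * (Real.exp (l * k) - 1) / b₁ ≤ κ * k) :
    ∑ p : (Fin s₁ → Fin b₁) × (Fin s₂ → Fin b₂), ∑ q : (Fin s₁ → Fin b₁) × (Fin s₂ → Fin b₂),
      Real.exp (l * ((Finset.univ.filter fun i => q.1 i = p.1 i).card *
        (Finset.univ.filter fun i => q.2 i = p.2 i).card)) ≤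
      (Fintype.card ((Fin s₁ → Fin b₁) × (Fin s₂ → Fin b₂)) : ℝ) ^ 2 *
        Real.exp (s₂ * (Real.exp κ - 1) / b₂) := by
  have hrow : ∀ p : (Fin s₁ → Fin b₁) × (Fin s₂ → Fin b₂),
      ∑ q : (Fin s₁ → Fin b₁) × (Fin s₂ → Fin b₂),
      Real.exp (l * ((Finset.univ.filter fun i => q.1 i = p.1 i).card *
        (Finset.univ.filter fun i => q.2 i = p.2 i).card)) ≤
      (b₁ : ℝ) ^ s₁ * ((b₂ : ℝ) ^ s₂ * Real.exp (s₂ * (Real.exp κ - 1) / b₂)) := by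
    intro p
    rw [Fintype.sum_prod_type_right]
    calc _ ≤ ∑ g : Fin s₂ → Fin b₂, (b₁ : ℝ) ^ s₁ *
          Real.exp (κ * (Finset.univ.filter fun i => g i = p.2 i).card) := by
            refine Finset.sum_le_sum fun g _ => ?_
            set k := (Finset.univ.filter fun i => g i = p.2 i).card with hk
            have hks : k ≤ s₂ := by
              simpa using Finset.card_le_univ (Finset.univ.filter fun i => g i = p.2 i)
            have h := sum_exp_card_agree_le hb₁ (l * k) p.1
            refine le_trans (le_of_eq ?_) (h.trans ?_)
            · exact Finset.sum_congr rfl fun f _ => by congr 1; ring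
            · exact mul_le_mul_of_nonneg_left (Real.exp_le_exp.2 (hκ k hks)) (by positivity)
      _ ≤ _ := by
            rw [← Finset.mul_sum]
            exact mul_le_mul_of_nonneg_left (sum_exp_card_agree_le hb₂ κ p.2) (by positivity)
  refine (Finset.sum_le_sum fun p _ => hrow p).trans (le_of_eq ?_)
  simp only [Finset.sum_const, Finset.card_univ, Fintype.card_prod, Fintype.card_fun,
    Fintype.card_fin, nsmul_eq_mul]
  push_cast
  ring

theorem one_sub_le_risk {d₁ d₂ s₁ s₂ b₁ b₂ : ℕ} (hb₁ : 0 < b₁) (hb₂ : 0 < b₂)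
    (h₁ : s₁ * b₁ ≤ d₁) (h₂ : s₂ * b₂ ≤ d₂) {μ κ δ : ℝ} (hδ : 0 < δ)
    (hκ : ∀ k : ℕ, k ≤ s₂ → s₁ * (Real.exp (μ ^ 2 * k) - 1) / b₁ ≤ κ * k)
    (hexp : Real.exp (s₂ * (Real.exp κ - 1) / b₂) ≤ 1 + δ ^ 2)
    {Δ : (Fin d₁ → Fin d₂ → ℝ) → Bool} (hΔ : Measurable Δ) :
    1 - δ ≤ risk d₁ d₂ s₁ s₂ μ Δ := by
  refine Pmeas_add_le_risk fun u hu => ?_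
  have : Nonempty (Fin b₁) := ⟨⟨0, hb₁⟩⟩
  have : Nonempty (Fin b₂) := ⟨⟨0, hb₂⟩⟩
  set X : (Fin s₁ → Fin b₁) × (Fin s₂ → Fin b₂) → Fin d₁ → Fin d₂ → ℝ := fun p i j =>
    μ * ((if i ∈ blockTransversal h₁ p.1 then 1 else 0) *
      (if j ∈ blockTransversal h₂ p.2 then 1 else 0)) with hX
  have hXmem : ∀ p, X p ∈ Theta d₁ d₂ s₁ s₂ μ := fun p =>
    ⟨blockTransversal h₁ p.1, blockTransversal h₂ p.2, card_blockTransversal _ _,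
      card_blockTransversal _ _, fun i j hi hj => by simp [hX, hi, hj], fun i j hij => by
        simp only [hX]
        by_cases hi : i ∈ blockTransversal h₁ p.1
        · have hj : j ∉ blockTransversal h₂ p.2 := fun hj => hij ⟨hi, hj⟩
          simp [hj]
        · simp [hi]⟩
  have hinner : ∀ p q, ∑ i, ∑ j, X p i j * X q i j =
      μ ^ 2 * ((Finset.univ.filter fun i => q.1 i = p.1 i).card *
        (Finset.univ.filter fun i => q.2 i = p.2 i).card) := by
    intro p q
    rw [← card_blockTransversal_inter h₁, ← card_blockTransversal_inter h₂]
    have hind : ∀ {d : ℕ} (S T : Finset (Fin d)), ((S ∩ T).card : ℝ) =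
        ∑ i, (if i ∈ T then (1 : ℝ) else 0) * (if i ∈ S then 1 else 0) := fun S T => by
      simp [← ite_and, Finset.filter_and]
    rw [hind, hind, Finset.sum_mul_sum, Finset.mul_sum]
    refine Finset.sum_congr rfl fun i _ => ?_
    rw [Finset.mul_sum]
    refine Finset.sum_congr rfl fun j _ => ?_
    simp only [hX]
    ring
  have hmeas : ∀ p, Measurable fun y : Fin d₁ → Fin d₂ → ℝ =>
      Real.exp (∑ i, ∑ j, (X p i j * y i j + -(X p i j ^ 2 / 2))) := fun p => by fun_prop
  refine one_sub_le_of_second_moment (Pmeas d₁ d₂ 0)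
    (fun p y => Real.exp (∑ i, ∑ j, (X p i j * y i j + -(X p i j ^ 2 / 2)))) hmeas
    (fun _ _ => (Real.exp_pos _).le) (fun p => ?_)
    (fun p q => Real.exp (∑ i, ∑ j, X p i j * X q i j)) (fun _ _ => (Real.exp_pos _).le)
    (fun p q => ?_) hδ ?_ (hΔ (measurableSet_singleton true)) (fun p => ?_)
  · rw [lintegral_exp_Pmeas]
    simp
  · simp_rw [← Real.exp_add, ← Finset.sum_add_distrib]
    have h := lintegral_exp_Pmeas (0 : Fin d₁ → Fin d₂ → ℝ) (fun i j => X p i j + X q i j)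
      (fun i j => -(X p i j ^ 2 / 2) + -(X q i j ^ 2 / 2))
    refine Eq.trans (lintegral_congr fun y => ?_) (h.trans ?_)
    · congr 3
      ext i
      refine Finset.sum_congr rfl fun j _ => by ring
    · congr 3
      ext i
      refine Finset.sum_congr rfl fun j _ => ?_
      simp only [Pi.zero_apply]
      ring
  · simp_rw [hinner]
    refine (sum_exp_card_agree_mul_le hb₁ hb₂ hκ).trans ?_
    exact mul_le_mul_of_nonneg_left hexp (by positivity)
  · rw [← Pmeas_eq_withDensity]
    have : (Δ ⁻¹' {true})ᶜ = {y | Δ y = false} := by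
      ext y; simp
    rw [this]
    exact hu _ (hXmem p)


theorem exp_mul_sub_one_le {t : ℝ} (ht0 : 0 ≤ t) (ht1 : t ≤ 1) (x : ℝ) :
    Real.exp (t * x) - 1 ≤ t * (Real.exp x - 1) := by
  have h := rpow_one_add_le_one_add_mul_self (s := Real.exp x - 1) (by linarith [Real.exp_pos x])
    ht0 ht1
  rw [add_sub_cancel, ← Real.exp_mul, mul_comm x t] at h
  linarith

theorem le_two_mul_mul_natDiv {d s : ℕ} (hs : 1 ≤ s) (hsd : s ≤ d) :
    (d : ℝ) ≤ 2 * s * (d / s : ℕ) := by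
  have h1 : d < s * (d / s + 1) := Nat.lt_mul_div_succ d hs
  have h2 : 1 ≤ d / s := (Nat.one_le_div_iff hs).2 hsd
  have h3 : d ≤ 2 * s * (d / s) := by nlinarith
  exact_mod_cast h3

theorem one_sub_le_risk_of_sq_lt {d₁ d₂ s₁ s₂ : ℕ} (hs₁ : 1 ≤ s₁) (hsd₁ : s₁ ≤ d₁) (hs₂ : 1 ≤ s₂)
    (hsd₂ : s₂ ≤ d₂) {α β δ μ : ℝ} (hδ : 0 < δ) (hα : 0 < α) (hβ : β = α / (2 * (2 + α)))
    (hsd : (s₂ : ℝ) ^ ((2 : ℝ) + α) ≤ d₂)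
    (hlog : 2 * Real.exp (-(β * Real.log d₂)) ≤ Real.log (1 + δ ^ 2))
    (hμ : μ ^ 2 < β / 2 * (1 / (s₂ : ℝ) *
      Real.log (1 + ((d₁ : ℝ) * s₂ / (s₁ : ℝ) ^ 2) * Real.log d₂)))
    {Δ : (Fin d₁ → Fin d₂ → ℝ) → Bool} (hΔ : Measurable Δ) :
    1 - δ ≤ risk d₁ d₂ s₁ s₂ μ Δ := by
  have hs₁' : (1 : ℝ) ≤ s₁ := by exact_mod_cast hs₁
  have hs₂' : (1 : ℝ) ≤ s₂ := by exact_mod_cast hs₂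
  have hd₁' : (1 : ℝ) ≤ d₁ := by exact_mod_cast hs₁.trans hsd₁
  have hd₂' : (1 : ℝ) ≤ d₂ := by exact_mod_cast hs₂.trans hsd₂
  have hb₁ : 0 < d₁ / s₁ := Nat.div_pos hsd₁ hs₁
  have hb₂ : 0 < d₂ / s₂ := Nat.div_pos hsd₂ hs₂
  have hb₁' : (0 : ℝ) < (d₁ / s₁ : ℕ) := by exact_mod_cast hb₁
  have hb₂' : (0 : ℝ) < (d₂ / s₂ : ℕ) := by exact_mod_cast hb₂
  have hle₁ := le_two_mul_mul_natDiv hs₁ hsd₁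
  have hle₂ := le_two_mul_mul_natDiv hs₂ hsd₂
  have hβ0 : 0 < β := by rw [hβ]; positivity
  have hβ1 : β ≤ 1 := by rw [hβ, div_le_one (by positivity)]; linarith
  set l := Real.log d₂ with hl
  have hl0 : 0 ≤ l := Real.log_nonneg hd₂'
  set ρ : ℝ := (d₁ : ℝ) * s₂ / (s₁ : ℝ) ^ 2 * l with hρ
  have hρ0 : 0 ≤ ρ := by positivity
  have hexpμ : Real.exp (μ ^ 2 * s₂) - 1 ≤ β / 2 * ρ := by
    have h1 : μ ^ 2 * s₂ ≤ β / 2 * Real.log (1 + ρ) := by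
      calc μ ^ 2 * s₂ ≤ β / 2 * (1 / (s₂ : ℝ) * Real.log (1 + ρ)) * s₂ := by gcongr
        _ = _ := by field_simp
    have h2 := exp_mul_sub_one_le (t := β / 2) (by positivity) (by linarith) (Real.log (1 + ρ))
    rw [Real.exp_log (by positivity)] at h2
    have h3 := Real.exp_le_exp.2 h1
    linarith
  refine one_sub_le_risk hb₁ hb₂ (Nat.mul_div_le _ _) (Nat.mul_div_le _ _) (κ := β * l) hδ
    (fun k hk => ?_) ?_ hΔ
  · have hk' : (k : ℝ) ≤ s₂ := by exact_mod_cast hk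
    have h1 := exp_mul_sub_one_le (t := (k : ℝ) / s₂) (by positivity)
      ((div_le_one (by positivity)).2 hk') (μ ^ 2 * s₂)
    rw [show (k : ℝ) / s₂ * (μ ^ 2 * s₂) = μ ^ 2 * k by field_simp] at h1
    have h2 : Real.exp (μ ^ 2 * k) - 1 ≤ (k : ℝ) / s₂ * (β / 2 * ρ) :=
      h1.trans (mul_le_mul_of_nonneg_left hexpμ (by positivity))
    rw [div_le_iff₀ hb₁']
    calc s₁ * (Real.exp (μ ^ 2 * k) - 1) ≤ s₁ * ((k : ℝ) / s₂ * (β / 2 * ρ)) := by gcongr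
      _ = β * l * k * (d₁ / (2 * s₁)) := by rw [hρ]; field_simp
      _ ≤ β * l * k * (d₁ / s₁ : ℕ) := by
          refine mul_le_mul_of_nonneg_left ?_ (by positivity)
          rw [div_le_iff₀ (by positivity)]
          linarith
  · rw [← Real.le_log_iff_exp_le (by positivity)]
    refine le_trans ?_ hlog
    have hs : 2 * Real.log s₂ ≤ 2 / (2 + α) * l := by
      have h := Real.log_le_log (by positivity) hsd
      rw [Real.log_rpow (by positivity)] at h
      rw [div_mul_eq_mul_div, le_div_iff₀ (by positivity)]
      linarith
    have hβα : 2 / (2 + α) + β - 1 = -β := by rw [hβ]; field_simp; ring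
    rw [div_le_iff₀ hb₂']
    calc (s₂ : ℝ) * (Real.exp (β * l) - 1) ≤ s₂ * Real.exp (β * l) := by gcongr; linarith
      _ = 2 * Real.exp (2 * Real.log s₂ + β * l - l) * (d₂ / (2 * s₂)) := by
          rw [Real.exp_sub, Real.exp_add, two_mul (Real.log _), Real.exp_add,
            Real.exp_log (by positivity), hl, Real.exp_log (by positivity)]
          field_simp
      _ ≤ 2 * Real.exp (-(β * l)) * (d₂ / s₂ : ℕ) := by
          have : 2 * Real.log s₂ + β * l - l ≤ -(β * l) := by
            calc _ ≤ 2 / (2 + α) * l + β * l - l := by linarith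
              _ = (2 / (2 + α) + β - 1) * l := by ring
              _ = _ := by rw [hβα]; ring
          gcongr
          rw [div_le_iff₀ (by positivity)]
          linarith


theorem measure_nonneg_le_lintegral_exp {Ω : Type*} [MeasurableSpace Ω] (P : Measure Ω)
    {f : Ω → ℝ} (hf : Measurable f) :
    P {x | 0 ≤ f x} ≤ ∫⁻ x, ENNReal.ofReal (Real.exp (f x)) ∂P := by
  have h := mul_meas_ge_le_lintegral (μ := P) (f := fun x => ENNReal.ofReal (Real.exp (f x)))
    (by fun_prop) 1
  rw [one_mul] at h
  refine le_trans (measure_mono fun x hx => ?_) h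
  simpa using hx

theorem lintegral_exp_sub_const {Ω : Type*} [MeasurableSpace Ω] (P : Measure Ω)
    (f : Ω → ℝ) (t : ℝ) :
    ∫⁻ x, ENNReal.ofReal (Real.exp (f x - t)) ∂P =
      (∫⁻ x, ENNReal.ofReal (Real.exp (f x)) ∂P) * ENNReal.ofReal (Real.exp (-t)) := by
  rw [← lintegral_mul_const' _ _ (by simp)]
  refine lintegral_congr fun x => ?_
  rw [← ENNReal.ofReal_mul (Real.exp_pos _).le, ← Real.exp_add, sub_eq_add_neg]

theorem measure_le_of_lintegral_exp_le {Ω : Type*} [MeasurableSpace Ω] (P : Measure Ω)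
    {f : Ω → ℝ} (hf : Measurable f) {t u : ℝ}
    (h : ∫⁻ x, ENNReal.ofReal (Real.exp (f x)) ∂P ≤ ENNReal.ofReal (Real.exp u)) :
    P {x | t ≤ f x} ≤ ENNReal.ofReal (Real.exp (u - t)) := by
  have h1 := measure_nonneg_le_lintegral_exp P (f := fun x => f x - t) (by fun_prop)
  rw [lintegral_exp_sub_const] at h1
  simp only [sub_nonneg] at h1
  refine h1.trans ?_
  rw [sub_eq_add_neg, Real.exp_add, ENNReal.ofReal_mul (Real.exp_pos _).le]
  gcongr

theorem Pmeas_linear_ge_le {d₁ d₂ : ℕ} (X A : Fin d₁ → Fin d₂ → ℝ) (t : ℝ) :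
    Pmeas d₁ d₂ X {y | t ≤ ∑ i, ∑ j, A i j * y i j} ≤
      ENNReal.ofReal (Real.exp (∑ i, ∑ j, (A i j * X i j + A i j ^ 2 / 2) - t)) := by
  refine measure_le_of_lintegral_exp_le _ (by fun_prop) ?_
  have h := lintegral_exp_Pmeas X A 0
  simp only [Pi.zero_apply, add_zero] at h
  exact h.le

theorem pi_gaussianReal_linear_ge_le {n : ℕ} (v a : Fin n → ℝ) (t : ℝ) :
    (Measure.pi fun j => gaussianReal (v j) 1) {y | t ≤ ∑ j, a j * y j} ≤
      ENNReal.ofReal (Real.exp (∑ j, (a j * v j + a j ^ 2 / 2) - t)) := by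
  refine measure_le_of_lintegral_exp_le _ (by fun_prop) ?_
  have h := lintegral_exp_sum_pi_gaussianReal v a 0
  simp only [Pi.zero_apply, add_zero] at h
  exact h.le

/-- Chernoff bound for the number of coordinates of a product measure that fall in a set. -/
theorem pi_count_ge_le {ι Ω : Type*} [Fintype ι] [MeasurableSpace Ω] (ν : ι → Measure Ω)
    [∀ i, IsProbabilityMeasure (ν i)] {H : Set Ω} (hH : MeasurableSet H) (θ t : ℝ) :
    Measure.pi ν {y | t ≤ ∑ i, θ * H.indicator 1 (y i)} ≤
      ENNReal.ofReal (Real.exp ((Real.exp θ - 1) * ∑ i, (ν i H).toReal - t)) := by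
  have hmeas : Measurable (H.indicator (1 : Ω → ℝ)) := measurable_one.indicator hH
  refine measure_le_of_lintegral_exp_le _ (by fun_prop) ?_
  simp_rw [Real.exp_sum, ENNReal.ofReal_prod_of_nonneg (fun _ _ => (Real.exp_pos _).le),
    Finset.mul_sum, Real.exp_sum, ENNReal.ofReal_prod_of_nonneg (fun _ _ => (Real.exp_pos _).le)]
  rw [lintegral_pi_prod ν (fun i y => ENNReal.ofReal (Real.exp (θ * H.indicator 1 y)))
    (fun i => by fun_prop)]
  refine Finset.prod_le_prod' fun i _ => ?_
  have h1 : ∀ y, ENNReal.ofReal (Real.exp (θ * H.indicator 1 y)) =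
      H.indicator (fun _ => ENNReal.ofReal (Real.exp θ)) y + Hᶜ.indicator (fun _ => 1) y := by
    intro y
    by_cases hy : y ∈ H <;> simp [hy]
  simp_rw [h1]
  rw [lintegral_add_left (measurable_const.indicator hH), lintegral_indicator_const hH,
    lintegral_indicator_const hH.compl, prob_compl_eq_one_sub hH, one_mul]
  set p := (ν i H).toReal with hp
  have hp' : ν i H = ENNReal.ofReal p := (ENNReal.ofReal_toReal (measure_ne_top _ _)).symm
  have hp0 : 0 ≤ p := ENNReal.toReal_nonneg
  have hp1 : p ≤ 1 := ENNReal.toReal_le_of_le_ofReal zero_le_one (by simpa using prob_le_one)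
  rw [hp', ← ENNReal.ofReal_one, ← ENNReal.ofReal_sub _ hp0,
    ← ENNReal.ofReal_mul (Real.exp_pos _).le, ← ENNReal.ofReal_add (by positivity) (by linarith)]
  refine ENNReal.ofReal_le_ofReal ?_
  linarith [Real.add_one_le_exp ((Real.exp θ - 1) * p)]

theorem exists_test_of_scan {d₁ d₂ s₁ s₂ : ℕ} (hs₂ : 1 ≤ s₂) (hd₂ : 1 ≤ d₂) {μ ε η : ℝ}
    (hη : 2 * ε < η) (hε : Real.exp (-Real.log d₂) ≤ ε)
    (R : Finset (Fin d₂) → Set (Fin d₁ → Fin d₂ → ℝ)) (hR : ∀ S, MeasurableSet (R S))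
    (hnull : ∀ S : Finset (Fin d₂), S.card = s₂ →
      Pmeas d₁ d₂ 0 (R S) ≤ ENNReal.ofReal (Real.exp (-(2 * (s₂ * Real.log d₂)))))
    (halt : ∀ (X : Fin d₁ → Fin d₂ → ℝ) (S₁ : Finset (Fin d₁)) (S₂ : Finset (Fin d₂)),
      S₁.card = s₁ → S₂.card = s₂ → (∀ i j, i ∈ S₁ → j ∈ S₂ → μ ≤ X i j) →
      (∀ i j, ¬(i ∈ S₁ ∧ j ∈ S₂) → X i j = 0) → Pmeas d₁ d₂ X (R S₂)ᶜ ≤ ENNReal.ofReal ε) :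
    ∃ Δ : (Fin d₁ → Fin d₂ → ℝ) → Bool, Measurable Δ ∧ risk d₁ d₂ s₁ s₂ μ Δ < η := by
  classical
  have hε0 : 0 ≤ ε := (Real.exp_pos _).le.trans hε
  have hd₂' : (0 : ℝ) < d₂ := by exact_mod_cast hd₂
  have hl0 : 0 ≤ Real.log d₂ := Real.log_nonneg (by exact_mod_cast hd₂)
  have hs₂' : (1 : ℝ) ≤ s₂ := by exact_mod_cast hs₂
  set U : Set (Fin d₁ → Fin d₂ → ℝ) :=
    ⋃ S ∈ Finset.univ.powersetCard s₂, R S with hU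
  have hUm : MeasurableSet U := Finset.measurableSet_biUnion _ fun S _ => hR S
  refine ⟨fun y => decide (y ∈ U), measurable_to_bool ?_, ?_⟩
  · convert hUm using 1
    ext y; simp
  have h1 : (Pmeas d₁ d₂ 0 {y | decide (y ∈ U) = true}).toReal ≤ ε := by
    refine ENNReal.toReal_le_of_le_ofReal hε0 ?_
    simp only [decide_eq_true_eq, Set.ofPred_mem_eq]
    calc Pmeas d₁ d₂ 0 U ≤ ∑ S ∈ Finset.univ.powersetCard s₂, Pmeas d₁ d₂ 0 (R S) :=
          measure_biUnion_finset_le _ _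
      _ ≤ ∑ S ∈ (Finset.univ : Finset (Fin d₂)).powersetCard s₂,
            ENNReal.ofReal (Real.exp (-(2 * (s₂ * Real.log d₂)))) :=
          Finset.sum_le_sum fun S hS => hnull S (Finset.mem_powersetCard.1 hS).2
      _ = ENNReal.ofReal (d₂.choose s₂ * Real.exp (-(2 * (s₂ * Real.log d₂)))) := by
          rw [Finset.sum_const, Finset.card_powersetCard, Finset.card_univ, Fintype.card_fin,
            nsmul_eq_mul, ENNReal.ofReal_mul (by positivity), ENNReal.ofReal_natCast]
      _ ≤ ENNReal.ofReal ε := by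
          refine ENNReal.ofReal_le_ofReal (le_trans ?_ hε)
          have hc : (d₂.choose s₂ : ℝ) ≤ Real.exp (s₂ * Real.log d₂) := by
            rw [Real.exp_nat_mul, Real.exp_log hd₂']
            exact_mod_cast Nat.choose_le_pow _ _
          calc _ ≤ Real.exp (s₂ * Real.log d₂) * Real.exp (-(2 * (s₂ * Real.log d₂))) := by gcongr
            _ ≤ _ := by
              rw [← Real.exp_add]
              exact Real.exp_le_exp.2 (by nlinarith)
  have h2 : ⨆ X ∈ Theta d₁ d₂ s₁ s₂ μ,
      (Pmeas d₁ d₂ X {y | decide (y ∈ U) = false}).toReal ≤ ε := by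
    refine Real.iSup_le (fun X => Real.iSup_le (fun hX => ?_) hε0) hε0
    obtain ⟨S₁, S₂, hc₁, hc₂, hge, hz⟩ := hX
    refine ENNReal.toReal_le_of_le_ofReal hε0 ((measure_mono ?_).trans
      (halt X S₁ S₂ hc₁ hc₂ hge hz))
    intro y hy
    simp only [Set.mem_ofPred_eq, decide_eq_false_iff_not] at hy
    intro hyR
    exact hy (Set.mem_biUnion (by simpa using hc₂) hyR)
  unfold risk
  linarith

theorem sum_ite_mem_sq {n : ℕ} (S : Finset (Fin n)) (a : ℝ) :
    ∑ j, (if j ∈ S then a else 0) ^ 2 / 2 = S.card * a ^ 2 / 2 := by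
  simp_rw [ite_pow, ite_div]
  simp
  ring

theorem le_sum_ite_mem_mul {n : ℕ} (S : Finset (Fin n)) {a m : ℝ} (ha : 0 ≤ a) (v : Fin n → ℝ)
    (hv : ∀ j ∈ S, m ≤ v j) : S.card * (a * m) ≤ ∑ j, (if j ∈ S then a else 0) * v j := by
  simp only [ite_mul, zero_mul, Finset.sum_ite_mem, Finset.univ_inter]
  rw [← nsmul_eq_mul]
  exact Finset.card_nsmul_le_sum _ _ _ fun j hj => mul_le_mul_of_nonneg_left (hv j hj) ha

theorem exists_test_of_linear {d₁ d₂ s₁ s₂ : ℕ} (hs₁ : 1 ≤ s₁) (hsd₁ : s₁ ≤ d₁)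
    (hs₂ : 1 ≤ s₂) (hd₂ : 1 ≤ d₂)
    {μ ε η : ℝ} (hμ0 : 0 < μ) (hη : 2 * ε < η) (hε : Real.exp (-Real.log d₂) ≤ ε)
    (hμ : 49 * d₁ * Real.log d₂ ≤ 4 * s₁ ^ 2 * μ ^ 2) :
    ∃ Δ : (Fin d₁ → Fin d₂ → ℝ) → Bool, Measurable Δ ∧ risk d₁ d₂ s₁ s₂ μ Δ < η := by
  set l := Real.log d₂ with hl
  have hl0 : 0 ≤ l := Real.log_nonneg (by exact_mod_cast hd₂)
  have hs₂' : (1 : ℝ) ≤ s₂ := by exact_mod_cast hs₂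
  have hd₁ : (0 : ℝ) < d₁ := by exact_mod_cast hs₁.trans hsd₁
  set θ : ℝ := 2 * √(l / d₁) with hθ
  have hθ0 : 0 ≤ θ := by positivity
  have hθ2 : d₁ * θ ^ 2 = 4 * l := by
    rw [hθ, mul_pow, Real.sq_sqrt (by positivity)]; field_simp; ring
  have hθμ : 7 * l ≤ θ * s₁ * μ := by
    refine (pow_le_pow_iff_left₀ (by positivity) (by positivity) two_ne_zero).1 ?_
    have : d₁ * (θ * s₁ * μ) ^ 2 = 4 * l * (s₁ ^ 2 * μ ^ 2) := by rw [← hθ2]; ring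
    refine le_of_mul_le_mul_left ?_ hd₁
    rw [this]
    nlinarith
  set A : Finset (Fin d₂) → Fin d₁ → Fin d₂ → ℝ := fun S _ j => if j ∈ S then θ else 0 with hA
  have hA2 : ∀ S : Finset (Fin d₂), S.card = s₂ →
      ∑ i, ∑ j, A S i j ^ 2 / 2 = 2 * (s₂ * l) := fun S hS => by
    simp only [hA, sum_ite_mem_sq, hS, Finset.sum_const, Finset.card_univ, Fintype.card_fin,
      nsmul_eq_mul]
    linear_combination (s₂ : ℝ) / 2 * hθ2
  refine exists_test_of_scan hs₂ hd₂ hη hε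
    (fun S => {y | 4 * (s₂ * l) ≤ ∑ i, ∑ j, A S i j * y i j}) (fun S => ?_) (fun S hS => ?_)
    (fun X S₁ S₂ hc₁ hc₂ hge hz => ?_)
  · exact measurableSet_le measurable_const (by fun_prop)
  · refine (Pmeas_linear_ge_le 0 (A S) _).trans (le_of_eq ?_)
    simp only [Pi.zero_apply, mul_zero, zero_add, hA2 S hS]
    congr 2
    ring
  · have hsub : {y : Fin d₁ → Fin d₂ → ℝ | 4 * (s₂ * l) ≤ ∑ i, ∑ j, A S₂ i j * y i j}ᶜ ⊆
        {y | -(4 * (s₂ * l)) ≤ ∑ i, ∑ j, -A S₂ i j * y i j} := fun y hy => by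
      simp only [Set.mem_compl_iff, Set.mem_ofPred_eq, not_le] at hy
      simp only [Set.mem_ofPred_eq, neg_mul, Finset.sum_neg_distrib]
      linarith
    refine (measure_mono hsub).trans ((Pmeas_linear_ge_le X (fun i j => -A S₂ i j) _).trans ?_)
    refine ENNReal.ofReal_le_ofReal (le_trans (Real.exp_le_exp.2 ?_) hε)
    simp only [neg_mul, neg_sq, Finset.sum_add_distrib, Finset.sum_neg_distrib, hA2 S₂ hc₂]
    have hsum : s₁ * (s₂ * (θ * μ)) ≤ ∑ i, ∑ j, A S₂ i j * X i j := by
      calc (s₁ : ℝ) * (s₂ * (θ * μ)) = ∑ i ∈ S₁, (s₂ : ℝ) * (θ * μ) := by simp [hc₁]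
        _ ≤ ∑ i ∈ S₁, ∑ j, A S₂ i j * X i j := Finset.sum_le_sum fun i hi => by
            rw [← hc₂]
            exact le_sum_ite_mem_mul S₂ hθ0 (X i) fun j hj => hge i j hi hj
        _ ≤ _ := by
            refine Finset.sum_le_sum_of_subset_of_nonneg (Finset.subset_univ _) fun i _ hi => ?_
            refine (Finset.sum_eq_zero fun j _ => ?_).ge
            rw [hz i j fun h => hi h.1, mul_zero]
    nlinarith [mul_le_mul_of_nonneg_left hθμ (by linarith : (0 : ℝ) ≤ s₂)]


theorem exp_sub_one_sub_le {x : ℝ} (hx : 0 ≤ x) : Real.exp x - 1 - x ≤ x ^ 2 * Real.exp x := by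
  have h1 := Real.add_one_le_exp (-x)
  have h2 : Real.exp x * Real.exp (-x) = 1 := by rw [← Real.exp_add]; simp
  have h3 : Real.exp x - 1 ≤ x * Real.exp x := by nlinarith [Real.exp_pos x]
  nlinarith

theorem pi_gaussianReal_sum_ge_le {n : ℕ} (S : Finset (Fin n)) (a : ℝ) :
    (Measure.pi fun _ : Fin n => gaussianReal 0 1)
      {y | S.card * a ^ 2 ≤ ∑ j, (if j ∈ S then a else 0) * y j} ≤
      ENNReal.ofReal (Real.exp (-(S.card * a ^ 2 / 2))) := by
  refine (pi_gaussianReal_linear_ge_le 0 (fun j => if j ∈ S then a else 0) _).trans (le_of_eq ?_)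
  simp only [Pi.zero_apply, mul_zero, zero_add, sum_ite_mem_sq]
  congr 2
  ring

theorem pi_gaussianReal_sum_lt_le {n : ℕ} (S : Finset (Fin n)) {a : ℝ} (ha : 0 ≤ a)
    {v : Fin n → ℝ} (hv : ∀ j ∈ S, 2 * a ≤ v j) :
    (Measure.pi fun j => gaussianReal (v j) 1)
      {y | S.card * a ^ 2 ≤ ∑ j, (if j ∈ S then a else 0) * y j}ᶜ ≤
      ENNReal.ofReal (Real.exp (-(S.card * a ^ 2 / 2))) := by
  have hsub : {y : Fin n → ℝ | S.card * a ^ 2 ≤ ∑ j, (if j ∈ S then a else 0) * y j}ᶜ ⊆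
      {y | -(S.card * a ^ 2) ≤ ∑ j, -(if j ∈ S then a else 0) * y j} := fun y hy => by
    simp only [Set.mem_compl_iff, Set.mem_ofPred_eq, not_le] at hy
    simp only [Set.mem_ofPred_eq, neg_mul, Finset.sum_neg_distrib]
    linarith
  refine (measure_mono hsub).trans
    ((pi_gaussianReal_linear_ge_le v (fun j => -(if j ∈ S then a else 0)) _).trans ?_)
  refine ENNReal.ofReal_le_ofReal (Real.exp_le_exp.2 ?_)
  simp only [neg_mul, neg_sq, Finset.sum_add_distrib, Finset.sum_neg_distrib, sum_ite_mem_sq]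
  have h := le_sum_ite_mem_mul S ha v hv
  linarith

theorem alternative_exponent_le {c s d w p q T : ℝ} (hc : 0 < c) (hs : 0 < s) (hsd : s ≤ d)
    (hw : 0 ≤ w) (hcw : c * w ≤ s) (hp0 : 0 ≤ p) (hpq : p ≤ q) (hq : q ≤ 1 / 8)
    (hqw : d * q * (w / s) ^ 2 ≤ w) (hT : (d - s) * p + s * (1 - q) ≤ T) :
    (Real.exp (-(c / (8 * (1 + c)) * (w / s))) - 1) * T -
      -(c / (8 * (1 + c)) * (w / s)) * (s / 2 + d * p) ≤ -(c / (64 * (1 + c)) * w) := by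
  set K : ℝ := c / (8 * (1 + c)) with hK
  have hK0 : 0 < K := by positivity
  set θ : ℝ := K * (w / s) with hθ
  have hθ0 : 0 ≤ θ := by positivity
  have hq0 : 0 ≤ q := hp0.trans hpq
  have hKc : K * (1 + 1 / c) = 1 / 8 := by rw [hK]; field_simp; ring
  have hsw : w / s ≤ 1 / c := by
    rw [div_le_div_iff₀ hs hc]; linarith
  have hθ1 : θ ≤ 1 := by
    have : θ ≤ K * (1 / c) := mul_le_mul_of_nonneg_left hsw hK0.le
    linarith
  have hexp : Real.exp (-θ) - 1 ≤ -(θ - θ ^ 2) := by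
    have h1 := (abs_le.1 (Real.abs_exp_sub_one_sub_id_le (x := -θ)
      (by rw [abs_neg, abs_of_nonneg hθ0]; exact hθ1))).2
    linarith [neg_sq θ]
  have hds : 0 ≤ d - s := by linarith
  have hsum0 : 0 ≤ (d - s) * p + s * (1 - q) := by
    have : 0 ≤ 1 - q := by linarith
    positivity
  have hθθ : 0 ≤ θ - θ ^ 2 := by nlinarith
  have h2 : θ * s = K * w := by rw [hθ]; field_simp
  calc _ ≤ -(θ - θ ^ 2) * ((d - s) * p + s * (1 - q)) - -θ * (s / 2 + d * p) := by
        refine sub_le_sub_right ?_ _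
        exact (mul_le_mul_of_nonneg_right hexp (hsum0.trans hT)).trans
          (mul_le_mul_of_nonpos_left hT (neg_nonpos.2 hθθ))
    _ = -(θ * s) * (1 / 2 - p - q) + θ ^ 2 * ((d - s) * p + s * (1 - q)) := by ring
    _ ≤ -(θ * s) * (1 / 4) + θ ^ 2 * (d * q + s) := by
        have h4 : (d - s) * p + s * (1 - q) ≤ d * q + s := by
          have h8 := mul_le_mul_of_nonneg_left hpq hds
          have h9 : 0 ≤ s * q := by positivity
          linarith
        have h5 : 0 ≤ θ * s := by positivity
        have h6 := mul_le_mul_of_nonneg_left h4 (sq_nonneg θ)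
        have h7 : θ * s * (1 / 4) ≤ θ * s * (1 / 2 - p - q) :=
          mul_le_mul_of_nonneg_left (by linarith) h5
        linarith
    _ = -(K * w) * (1 / 4) + K ^ 2 * (d * q * (w / s) ^ 2 + w / s * w) := by
        have h6 : θ ^ 2 * (d * q + s) =
            K ^ 2 * (d * q * (w / s) ^ 2) + K * (w / s) * (θ * s) := by
          rw [hθ]; ring
        rw [h6, h2]; ring
    _ ≤ -(K * w) * (1 / 4) + K ^ 2 * (w + 1 / c * w) := by gcongr
    _ = K * w * (-(1 / 4) + K * (1 + 1 / c)) := by ring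
    _ = -(c / (64 * (1 + c)) * w) := by
        rw [hKc, show c / (64 * (1 + c)) = K / 8 by rw [hK]; field_simp; norm_num]
        ring

theorem exists_test_of_threshold {d₁ d₂ s₁ s₂ : ℕ} (hs₁ : 1 ≤ s₁) (hsd₁ : s₁ ≤ d₁)
    (hs₂ : 1 ≤ s₂) (hd₂ : 1 ≤ d₂) {c μ ε η q ρ : ℝ} (hc : 0 < c) (hμ0 : 0 < μ)
    (hη : 2 * ε < η) (hε : Real.exp (-(c / (64 * (1 + c)) * Real.log d₂)) ≤ ε)
    (hs : c * (s₂ * Real.log d₂) ≤ s₁) (hq : q = Real.exp (-(s₂ * μ ^ 2 / 8)))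
    (hρ : ρ = (d₁ : ℝ) * s₂ / (s₁ : ℝ) ^ 2 * Real.log d₂)
    (hq8 : q ≤ 1 / 8) (hqρ : 36 * Real.exp (6 / c) * (q * ρ) ≤ 1) :
    ∃ Δ : (Fin d₁ → Fin d₂ → ℝ) → Bool, Measurable Δ ∧ risk d₁ d₂ s₁ s₂ μ Δ < η := by
  set l := Real.log d₂ with hl
  have hl0 : 0 ≤ l := Real.log_nonneg (by exact_mod_cast hd₂)
  have hs₁' : (1 : ℝ) ≤ s₁ := by exact_mod_cast hs₁
  have hs₂' : (1 : ℝ) ≤ s₂ := by exact_mod_cast hs₂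
  have hsd₁' : (s₁ : ℝ) ≤ d₁ := by exact_mod_cast hsd₁
  have hq0 : 0 < q := by rw [hq]; positivity
  have hw0 : 0 ≤ s₂ * l := by positivity
  have hlw : l ≤ s₂ * l := by nlinarith
  have hsw : s₂ * l / s₁ ≤ 1 / c := by
    rw [div_le_div_iff₀ (by positivity) hc]; linarith
  have hdρ : d₁ * q * (s₂ * l / s₁) ^ 2 = q * ρ * (s₂ * l) := by rw [hρ]; field_simp
  set H : Finset (Fin d₂) → Set (Fin d₂ → ℝ) := fun S =>
    {y | S.card * (μ / 2) ^ 2 ≤ ∑ j, (if j ∈ S then μ / 2 else 0) * y j} with hH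
  have hHm : ∀ S, MeasurableSet (H S) := fun S =>
    measurableSet_le measurable_const (by fun_prop)
  have hqS : ∀ S : Finset (Fin d₂), S.card = s₂ → Real.exp (-(S.card * (μ / 2) ^ 2 / 2)) = q :=
    fun S hS => by rw [hS, hq]; congr 1; ring
  set p : Finset (Fin d₂) → ℝ := fun S =>
    ((Measure.pi fun _ : Fin d₂ => gaussianReal 0 1) (H S)).toReal with hp
  have hp0 : ∀ S, 0 ≤ p S := fun S => ENNReal.toReal_nonneg
  have hpq : ∀ S : Finset (Fin d₂), S.card = s₂ → p S ≤ q := fun S hS => by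
    refine ENNReal.toReal_le_of_le_ofReal hq0.le ?_
    have h := pi_gaussianReal_sum_ge_le S (μ / 2)
    rwa [hqS S hS] at h
  refine exists_test_of_scan hs₂ hd₂ hη (le_trans (Real.exp_le_exp.2 ?_) hε)
    (fun S => {y | s₁ / 2 + d₁ * p S ≤ ∑ i, (H S).indicator 1 (y i)}) (fun S => ?_)
    (fun S hS => ?_) (fun X S₁ S₂ hc₁ hc₂ hge hz => ?_)
  · have : c / (64 * (1 + c)) ≤ 1 := by rw [div_le_one (by positivity)]; linarith
    nlinarith
  · refine measurableSet_le measurable_const (Finset.measurable_sum _ fun i _ => ?_)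
    exact (measurable_one.indicator (hHm S)).comp (measurable_pi_apply i)
  · set θ : ℝ := 6 * (s₂ * l / s₁) with hθ
    have hθ0 : 0 ≤ θ := by positivity
    have hθc : θ ≤ 6 / c := by rw [hθ]; linarith [mul_one_div 6 c]
    have h := pi_count_ge_le (fun _ : Fin d₁ => Measure.pi fun _ : Fin d₂ => gaussianReal 0 1)
      (hHm S) θ (θ * (s₁ / 2 + d₁ * p S))
    refine (measure_mono fun y hy => ?_).trans (h.trans ?_)
    · simp only [Set.mem_ofPred_eq, ← Finset.mul_sum] at hy ⊢
      exact mul_le_mul_of_nonneg_left hy hθ0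
    · refine ENNReal.ofReal_le_ofReal (Real.exp_le_exp.2 ?_)
      simp only [Finset.sum_const, Finset.card_univ, Fintype.card_fin, nsmul_eq_mul]
      have h1 : Real.exp θ - 1 - θ ≤ θ ^ 2 * Real.exp (6 / c) :=
        (exp_sub_one_sub_le hθ0).trans (by gcongr)
      have h2 : θ * s₁ = 6 * (s₂ * l) := by rw [hθ]; field_simp
      calc (Real.exp θ - 1) * (d₁ * p S) - θ * (s₁ / 2 + d₁ * p S)
          = (Real.exp θ - 1 - θ) * (d₁ * p S) - θ * s₁ / 2 := by ring
        _ ≤ (θ ^ 2 * Real.exp (6 / c)) * (d₁ * q) - θ * s₁ / 2 := by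
            have := hp0 S
            have := hpq S hS
            gcongr
        _ = 36 * Real.exp (6 / c) * (d₁ * q * (s₂ * l / s₁) ^ 2) - θ * s₁ / 2 := by
            rw [hθ]; ring
        _ = (36 * Real.exp (6 / c) * (q * ρ)) * (s₂ * l) - 3 * (s₂ * l) := by
            rw [hdρ, h2]; ring
        _ ≤ 1 * (s₂ * l) - 3 * (s₂ * l) := by gcongr
        _ = -(2 * (s₂ * l)) := by ring
  · set K : ℝ := c / (8 * (1 + c)) with hK
    have hK0 : 0 < K := by positivity
    set θ : ℝ := K * (s₂ * l / s₁) with hθ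
    have hθ0 : 0 ≤ θ := by positivity
    have h := pi_count_ge_le (fun i : Fin d₁ => Measure.pi fun j : Fin d₂ => gaussianReal (X i j) 1)
      (hHm S₂) (-θ) (-θ * (s₁ / 2 + d₁ * p S₂))
    refine (measure_mono fun y hy => ?_).trans (h.trans ?_)
    · simp only [Set.mem_compl_iff, Set.mem_ofPred_eq, not_le] at hy
      simp only [Set.mem_ofPred_eq, ← Finset.mul_sum]
      nlinarith
    · refine ENNReal.ofReal_le_ofReal (le_trans (Real.exp_le_exp.2 ?_) hε)
      have hsum : (d₁ - s₁) * p S₂ + s₁ * (1 - q) ≤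
          ∑ i, ((Measure.pi fun j => gaussianReal (X i j) 1) (H S₂)).toReal := by
        have hin : ∀ i ∈ S₁, 1 - q ≤
            ((Measure.pi fun j => gaussianReal (X i j) 1) (H S₂)).toReal := fun i hi => by
          have h1 := pi_gaussianReal_sum_lt_le S₂ (a := μ / 2) (v := X i) (by positivity)
            fun j hj => by linarith [hge i j hi hj]
          rw [hqS S₂ hc₂] at h1
          have h2 := ENNReal.toReal_le_of_le_ofReal hq0.le h1
          have h3 := probReal_compl_eq_one_sub
            (μ := Measure.pi fun j => gaussianReal (X i j) 1) (hHm S₂)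
          simp only [measureReal_def] at h3
          change ((Measure.pi fun j => gaussianReal (X i j) 1) (H S₂)ᶜ).toReal ≤ q at h2
          linarith
        have hout : ∀ i ∈ S₁ᶜ, p S₂ ≤
            ((Measure.pi fun j => gaussianReal (X i j) 1) (H S₂)).toReal := fun i hi => by
          have : ∀ j, X i j = 0 := fun j => hz i j fun h => Finset.mem_compl.1 hi h.1
          simp only [this]
          exact le_rfl
        rw [← Finset.sum_add_sum_compl S₁, add_comm]
        refine add_le_add ?_ ?_
        · rw [← hc₁, ← nsmul_eq_mul]
          exact Finset.card_nsmul_le_sum _ _ _ hin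
        · have hcard : ((S₁ᶜ.card : ℕ) : ℝ) = d₁ - s₁ := by
            rw [Finset.card_compl, Fintype.card_fin, hc₁, Nat.cast_sub hsd₁]
          rw [← hcard, ← nsmul_eq_mul]
          exact Finset.card_nsmul_le_sum _ _ _ hout
      have hqρ1 : q * ρ ≤ 1 := by
        have h1 : 1 ≤ Real.exp (6 / c) := Real.one_le_exp (by positivity)
        have h3 : 0 ≤ q * ρ := by rw [hρ]; positivity
        have h4 := mul_le_mul_of_nonneg_right h1 h3
        linarith
      have hqw : d₁ * q * (s₂ * l / s₁) ^ 2 ≤ s₂ * l :=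
        hdρ.trans_le (mul_le_of_le_one_left hw0 hqρ1)
      refine (alternative_exponent_le hc (by positivity) hsd₁' hw0 hs (hp0 S₂) (hpq S₂ hc₂) hq8
        hqw hsum).trans ?_
      gcongr


theorem exp_neg_mul_le_of_abs_le {κ l u : ℝ} (hκ : 0 < κ) (hu : 0 < u)
    (hl : |Real.log u / κ| ≤ l) : Real.exp (-(κ * l)) ≤ u := by
  rw [← Real.le_log_iff_exp_le hu]
  have h := (neg_abs_le (Real.log u / κ)).trans' (neg_le_neg hl)
  rw [le_div_iff₀ hκ] at h
  linarith

theorem le_muStar_sq {η t : ℝ} {d₁ d₂ s₁ s₂ : ℕ} (ht : 0 ≤ t)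
    (hne : ∃ μ : ℝ, 0 < μ ∧ ∃ Δ : (Fin d₁ → Fin d₂ → ℝ) → Bool,
      Measurable Δ ∧ risk d₁ d₂ s₁ s₂ μ Δ < η)
    (h : ∀ μ : ℝ, 0 < μ → ∀ Δ : (Fin d₁ → Fin d₂ → ℝ) → Bool,
      Measurable Δ → risk d₁ d₂ s₁ s₂ μ Δ < η → t ≤ μ ^ 2) :
    t ≤ muStar η d₁ d₂ s₁ s₂ ^ 2 := by
  have h1 : √t ≤ muStar η d₁ d₂ s₁ s₂ := le_csInf hne fun μ ⟨hμ, Δ, hΔ, hr⟩ =>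
    Real.sqrt_le_iff.2 ⟨hμ.le, h μ hμ Δ hΔ hr⟩
  calc t = √t ^ 2 := (Real.sq_sqrt ht).symm
    _ ≤ _ := by gcongr

theorem muStar_sq_le {η μ : ℝ} {d₁ d₂ s₁ s₂ : ℕ} (hμ : 0 < μ)
    (h : ∃ Δ : (Fin d₁ → Fin d₂ → ℝ) → Bool, Measurable Δ ∧ risk d₁ d₂ s₁ s₂ μ Δ < η) :
    muStar η d₁ d₂ s₁ s₂ ^ 2 ≤ μ ^ 2 := by
  have h0 : 0 ≤ muStar η d₁ d₂ s₁ s₂ := Real.sInf_nonneg fun x hx => hx.1.le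
  have h1 : muStar η d₁ d₂ s₁ s₂ ≤ μ := csInf_le ⟨0, fun x hx => hx.1.le⟩ ⟨hμ, h⟩
  gcongr

theorem thirty_six_mul_exp_mul_le {c ρ q : ℝ} (hc : 0 < c) (hρ : 1 ≤ ρ)
    (hq : q = Real.exp (-((9 + 12 / c) * Real.log (1 + ρ)))) :
    36 * Real.exp (6 / c) * (q * (1 + ρ)) ≤ 1 := by
  have hlog : 1 / 2 ≤ Real.log (1 + ρ) := by
    have := Real.log_le_log two_pos (by linarith : (2 : ℝ) ≤ 1 + ρ)
    linarith [Real.log_two_gt_d9]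
  have h1 : q * (1 + ρ) = Real.exp (-((8 + 12 / c) * Real.log (1 + ρ))) := by
    rw [hq]
    nth_rw 2 [← Real.exp_log (by linarith : 0 < 1 + ρ)]
    rw [← Real.exp_add]
    congr 1
    ring
  have h2 : (8 + 12 / c) * (1 / 2) ≤ (8 + 12 / c) * Real.log (1 + ρ) := by gcongr
  have h3 : q * (1 + ρ) ≤ Real.exp (-4 - 6 / c) := by
    rw [h1]
    refine Real.exp_le_exp.2 ?_
    have : (8 + 12 / c) * (1 / 2) = 4 + 6 / c := by ring
    linarith
  have h4 : (36 : ℝ) ≤ Real.exp 4 := by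
    have h := Real.exp_one_gt_d9
    calc (36 : ℝ) ≤ 2.7 ^ 4 := by norm_num
      _ ≤ Real.exp 1 ^ 4 := by gcongr; linarith
      _ = Real.exp 4 := by rw [← Real.exp_nat_mul]; norm_num
  have h5 : 0 ≤ q * (1 + ρ) := h1 ▸ (Real.exp_pos _).le
  calc _ ≤ Real.exp 4 * Real.exp (6 / c) * Real.exp (-4 - 6 / c) := by gcongr
    _ = 1 := by rw [← Real.exp_add, ← Real.exp_add]; simp

theorem exists_test_of_sq_eq {d₁ d₂ s₁ s₂ : ℕ} (hs₁ : 1 ≤ s₁) (hsd₁ : s₁ ≤ d₁) (hs₂ : 1 ≤ s₂)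
    (hd₂ : 1 ≤ d₂) {c μ ε η : ℝ} (hc : 0 < c) (hμ0 : 0 < μ)
    (hη : 2 * ε < η) (hε : Real.exp (-(c / (64 * (1 + c)) * Real.log d₂)) ≤ ε)
    (hs : c * (s₂ * Real.log d₂) ≤ s₁)
    (hμ : μ ^ 2 = (72 + 96 / c) * (1 / (s₂ : ℝ) *
      Real.log (1 + ((d₁ : ℝ) * s₂ / (s₁ : ℝ) ^ 2) * Real.log d₂))) :
    ∃ Δ : (Fin d₁ → Fin d₂ → ℝ) → Bool, Measurable Δ ∧ risk d₁ d₂ s₁ s₂ μ Δ < η := by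
  have hs₁' : (1 : ℝ) ≤ s₁ := by exact_mod_cast hs₁
  have hs₂' : (1 : ℝ) ≤ s₂ := by exact_mod_cast hs₂
  have hl0 : 0 ≤ Real.log d₂ := Real.log_nonneg (by exact_mod_cast hd₂)
  set ρ : ℝ := (d₁ : ℝ) * s₂ / (s₁ : ℝ) ^ 2 * Real.log d₂ with hρ
  have hρ0 : 0 ≤ ρ := by positivity
  rcases le_total ρ 1 with hρ1 | hρ1
  · have hκ1 : c / (64 * (1 + c)) ≤ 1 := by rw [div_le_one (by positivity)]; linarith
    refine exists_test_of_linear hs₁ hsd₁ hs₂ hd₂ hμ0 hη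
      (le_trans (Real.exp_le_exp.2 ?_) hε) ?_
    · have := mul_le_of_le_one_left hl0 hκ1
      linarith
    · have h1 : 2 / 3 * ρ ≤ Real.log (1 + ρ) := by
        refine le_trans ?_ (Real.le_log_one_add_of_nonneg hρ0)
        rw [le_div_iff₀ (by positivity)]
        nlinarith
      have h2 : 0 < 96 / c := by positivity
      rw [hμ]
      calc 49 * d₁ * Real.log d₂ ≤ 4 * 72 * (2 / 3) * (d₁ * Real.log d₂) := by
            have : 0 ≤ d₁ * Real.log d₂ := by positivity
            linarith
        _ = 4 * s₁ ^ 2 * (72 * (1 / s₂ * (2 / 3 * ρ))) := by rw [hρ]; field_simp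
        _ ≤ 4 * s₁ ^ 2 * ((72 + 96 / c) * (1 / s₂ * Real.log (1 + ρ))) := by
            gcongr
            linarith
  · have hq : Real.exp (-(s₂ * μ ^ 2 / 8)) =
        Real.exp (-((9 + 12 / c) * Real.log (1 + ρ))) := by
      rw [hμ]; congr 2; field_simp; ring
    have h36 := thirty_six_mul_exp_mul_le hc hρ1 hq
    set q := Real.exp (-(s₂ * μ ^ 2 / 8)) with hqdef
    have hq0 : 0 < q := Real.exp_pos _
    have h1 : 1 ≤ Real.exp (6 / c) := Real.one_le_exp (by positivity)
    refine exists_test_of_threshold hs₁ hsd₁ hs₂ hd₂ hc hμ0 hη hε hs hqdef hρ ?_ ?_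
    · have h2 : 36 * 1 * (q * 1) ≤ 36 * Real.exp (6 / c) * (q * (1 + ρ)) := by
        gcongr
        linarith
      linarith
    · refine le_trans ?_ h36
      gcongr
      linarith

theorem mul_log_le_of_sq_le {d₁ d₂ s₁ s₂ : ℕ} {c α : ℝ} (hs₁ : 1 ≤ s₁) (hs₂ : 1 ≤ s₂)
    (hd₂ : 1 ≤ d₂) (hα : 0 < α) (hsq : c * (d₁ : ℝ) * s₂ ≤ (s₁ : ℝ) ^ 2) (hc : 0 < c)
    (hlog : Real.exp 1 * Real.log ((d₂ : ℝ) / s₂) ≤ (d₁ : ℝ) / s₁)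
    (hsd : (s₂ : ℝ) ^ ((2 : ℝ) + α) ≤ d₂) : c * (s₂ * Real.log d₂) ≤ s₁ := by
  have hs₁' : (0 : ℝ) < s₁ := by exact_mod_cast hs₁
  have hs₂' : (1 : ℝ) ≤ s₂ := by exact_mod_cast hs₂
  have hd₂' : (1 : ℝ) ≤ d₂ := by exact_mod_cast hd₂
  have hl0 : 0 ≤ Real.log d₂ := Real.log_nonneg hd₂'
  have hls : 0 ≤ Real.log s₂ := Real.log_nonneg hs₂'
  have h1 := Real.log_le_log (by positivity) hsd
  rw [Real.log_rpow (by positivity)] at h1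
  rw [Real.log_div (by positivity) (by positivity)] at hlog
  have h2 : Real.log d₂ ≤ d₁ / s₁ := by
    refine le_trans ?_ hlog
    have he : 2 ≤ Real.exp 1 := by linarith [Real.exp_one_gt_d9]
    have hhalf : Real.log d₂ / 2 ≤ Real.log d₂ - Real.log s₂ := by nlinarith
    nlinarith
  rw [le_div_iff₀ hs₁'] at h2
  refine le_of_mul_le_mul_right ?_ hs₁'
  calc c * (s₂ * Real.log d₂) * s₁ = c * (Real.log d₂ * s₁) * s₂ := by ring
    _ ≤ c * d₁ * s₂ := by gcongr
    _ ≤ s₁ ^ 2 := hsq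
    _ = s₁ * s₁ := sq _

/-- New phase transition (Corollary 2):
(μ*)² ≍ (1/s₂)·log(1 + (d₁·s₂/s₁²)·log d₂). -/
theorem new_phase_transition (η cbar α : ℝ) (hη0 : 0 < η) (hη1 : η < 1)
    (hcbar : 0 < cbar) (hα : 0 < α) :
    ∃ c₁ c₂ c C : ℝ, 0 < c₁ ∧ 0 < c₂ ∧ 0 < c ∧ 0 < C ∧
      ∀ (d₁ d₂ s₁ s₂ : ℕ), 0 < d₁ → 0 < d₂ →
        1 ≤ s₁ → s₁ ≤ d₁ → 1 ≤ s₂ → s₂ ≤ d₂ →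
        cbar * (d₁ : ℝ) * (s₂ : ℝ) ≤ (s₁ : ℝ) ^ 2 →
        (s₁ : ℝ) ≤ c₁ * (d₁ : ℝ) →
        (s₂ : ℝ) ≤ c₂ * (d₂ : ℝ) →
        Real.exp 1 * Real.log ((d₂ : ℝ) / (s₂ : ℝ)) ≤ (d₁ : ℝ) / (s₁ : ℝ) →
        (s₂ : ℝ) ^ ((2 : ℝ) + α) ≤ (d₂ : ℝ) →
        c * ((1 / (s₂ : ℝ)) *
              Real.log (1 + ((d₁ : ℝ) * (s₂ : ℝ) / (s₁ : ℝ) ^ 2) *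
                Real.log (d₂ : ℝ))) ≤ (muStar η d₁ d₂ s₁ s₂) ^ 2 ∧
        (muStar η d₁ d₂ s₁ s₂) ^ 2 ≤
          C * ((1 / (s₂ : ℝ)) *
              Real.log (1 + ((d₁ : ℝ) * (s₂ : ℝ) / (s₁ : ℝ) ^ 2) *
                Real.log (d₂ : ℝ))) := by
  set δ : ℝ := 1 - η with hδdef
  have hδ : 0 < δ := by linarith
  set β : ℝ := α / (2 * (2 + α)) with hβ
  have hβ0 : 0 < β := by positivity
  set κ : ℝ := cbar / (64 * (1 + cbar)) with hκ
  have hκ0 : 0 < κ := by positivity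
  have hlogδ : 0 < Real.log (1 + δ ^ 2) := Real.log_pos (by nlinarith)
  set B₁ : ℝ := |Real.log (Real.log (1 + δ ^ 2) / 2) / β| with hB₁
  set B₂ : ℝ := |Real.log (η / 4) / κ| with hB₂
  have hB₁0 : 0 ≤ B₁ := abs_nonneg _
  have hB₂0 : 0 ≤ B₂ := abs_nonneg _
  refine ⟨1, Real.exp (-(B₁ + B₂ + 1)), β / 2, 72 + 96 / cbar, one_pos, Real.exp_pos _,
    by positivity, by positivity, ?_⟩
  intro d₁ d₂ s₁ s₂ hd₁ hd₂ hs₁ hsd₁ hs₂ hsd₂ hsq _ hc₂ hlog hsd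
  have hs₁' : (1 : ℝ) ≤ s₁ := by exact_mod_cast hs₁
  have hs₂' : (1 : ℝ) ≤ s₂ := by exact_mod_cast hs₂
  have hd₁' : (0 : ℝ) < d₁ := by exact_mod_cast hd₁
  have hd₂' : (0 : ℝ) < d₂ := by exact_mod_cast hd₂
  have hl : B₁ + B₂ + 1 ≤ Real.log d₂ := by
    rw [Real.le_log_iff_exp_le hd₂']
    rw [Real.exp_neg, ← div_eq_inv_mul, le_div_iff₀ (Real.exp_pos _)] at hc₂
    nlinarith [Real.exp_pos (B₁ + B₂ + 1)]
  have hl0 : 0 < Real.log d₂ := by linarith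
  set T : ℝ := 1 / (s₂ : ℝ) *
    Real.log (1 + ((d₁ : ℝ) * s₂ / (s₁ : ℝ) ^ 2) * Real.log d₂) with hT
  have hT0 : 0 < T := by
    have : 0 < ((d₁ : ℝ) * s₂ / (s₁ : ℝ) ^ 2) * Real.log d₂ := by positivity
    have := Real.log_pos (by linarith : 1 < 1 + ((d₁ : ℝ) * s₂ / (s₁ : ℝ) ^ 2) * Real.log d₂)
    positivity
  have hCT : 0 < (72 + 96 / cbar) * T := by positivity
  have hμsq : √((72 + 96 / cbar) * T) ^ 2 = (72 + 96 / cbar) * T := Real.sq_sqrt hCT.le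
  have hμ0 : 0 < √((72 + 96 / cbar) * T) := Real.sqrt_pos.2 hCT
  have hB₂l : B₂ ≤ Real.log d₂ := by linarith
  have hε := exp_neg_mul_le_of_abs_le hκ0 (by positivity) hB₂l
  have htest := exists_test_of_sq_eq hs₁ hsd₁ hs₂ hd₂ hcbar hμ0 (ε := η / 4) (η := η)
    (by linarith) hε
    (mul_log_le_of_sq_le hs₁ hs₂ hd₂ hα hsq hcbar hlog hsd) hμsq
  refine ⟨le_muStar_sq (by positivity) ⟨_, hμ0, htest⟩ fun μ _ Δ hΔ hr => ?_, ?_⟩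
  · by_contra! hlt
    have hβlog : 2 * Real.exp (-(β * Real.log d₂)) ≤ Real.log (1 + δ ^ 2) := by
      have := exp_neg_mul_le_of_abs_le (l := Real.log d₂) hβ0 (half_pos hlogδ) (by linarith)
      linarith
    have := one_sub_le_risk_of_sq_lt hs₁ hsd₁ hs₂ hsd₂ hδ hα hβ hsd hβlog hlt hΔ
    linarith
  · rw [← hμsq]
    exact muStar_sq_le hμ0 htest
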